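/- Let (k,X,Ω,A,K) be an instance of weight-constrained anisotropic clustering, ε ∈ (0,1/2], δ ∈ [1,∞), let (X̃,Ω̃) be an (ε/3,δ)-coreset for it with extension f, let S be a k-tuple of sites, let C̃ ∈ C_K(k,X̃,Ω̃), and let γ ∈ ℝ with γ ≥ δ. If C̃ is a γ-approximation for the assignment instance (k,X̃,Ω̃,A,K,S), then f(C̃) is a (1+ε)γ-approximation for the assignment instance (k,X,Ω,A,K,S). -/

import Mathlib

open Finset Matrix

noncomputable section

/-- Squared anisotropic (ellipsoidal) norm `‖v‖_A² = vᵀ A v`. -/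
def anormSq {d : ℕ} (A : Matrix (Fin d) (Fin d) ℝ) (v : Fin d → ℝ) : ℝ :=
  v ⬝ᵥ A.mulVec v

/-- `ξ` is a (fractional) `k`-clustering of `n` points. -/
def IsClustering {k n : ℕ} (ξ : Fin k → Fin n → ℝ) : Prop :=
  (∀ i j, 0 ≤ ξ i j) ∧ ∀ j, ∑ i, ξ i j = 1

/-- The weight `ω(C_i)` of the `i`-th cluster. -/
def clusterWeight {k n : ℕ} (ω : Fin n → ℝ) (ξ : Fin k → Fin n → ℝ) (i : Fin k) : ℝ :=
  ∑ j, ξ i j * ω j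

/-- `ξ` is a weight-constrained `k`-clustering (an element of `C_K(k,X,Ω)`). -/
def IsWCC {k n : ℕ} (κlo κhi : Fin k → ℝ) (ω : Fin n → ℝ) (ξ : Fin k → Fin n → ℝ) : Prop :=
  IsClustering ξ ∧ ∀ i, κlo i ≤ clusterWeight ω ξ i ∧ clusterWeight ω ξ i ≤ κhi i

/-- `cost_{A,K}(X,C,S)`. -/
def cost {d k n : ℕ} (A : Fin k → Matrix (Fin d) (Fin d) ℝ)
    (x : Fin n → Fin d → ℝ) (ω : Fin n → ℝ) (ξ : Fin k → Fin n → ℝ)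
    (s : Fin k → Fin d → ℝ) : ℝ :=
  ∑ i, ∑ j, ξ i j * ω j * anormSq (A i) (x j - s i)

/-- `cost_{A,K}(X,S)`: optimal constrained assignment cost for fixed sites `s`. -/
def assignCost {d k n : ℕ} (κlo κhi : Fin k → ℝ) (A : Fin k → Matrix (Fin d) (Fin d) ℝ)
    (x : Fin n → Fin d → ℝ) (ω : Fin n → ℝ) (s : Fin k → Fin d → ℝ) : ℝ :=
  sInf {c : ℝ | ∃ ξ, IsWCC κlo κhi ω ξ ∧ c = cost A x ω ξ s}

/-- `cost_{A,K}(X,C)`: infimum over site tuples. -/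
def clusterCost {d k n : ℕ} (A : Fin k → Matrix (Fin d) (Fin d) ℝ)
    (x : Fin n → Fin d → ℝ) (ω : Fin n → ℝ) (ξ : Fin k → Fin n → ℝ) : ℝ :=
  sInf {c : ℝ | ∃ s : Fin k → Fin d → ℝ, c = cost A x ω ξ s}

/-- `OPT_{A,K}(X)`. -/
def OPTc {d k n : ℕ} (κlo κhi : Fin k → ℝ) (A : Fin k → Matrix (Fin d) (Fin d) ℝ)
    (x : Fin n → Fin d → ℝ) (ω : Fin n → ℝ) : ℝ :=
  sInf {c : ℝ | ∃ ξ, IsWCC κlo κhi ω ξ ∧ c = clusterCost A x ω ξ}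

/-- Unconstrained optimum `OPT_A(X)` (over all clusterings and all site tuples). -/
def OPTu {d k n : ℕ} (A : Fin k → Matrix (Fin d) (Fin d) ℝ)
    (x : Fin n → Fin d → ℝ) (ω : Fin n → ℝ) : ℝ :=
  sInf {c : ℝ | ∃ ξ, ∃ s : Fin k → Fin d → ℝ, IsClustering ξ ∧ c = cost A x ω ξ s}

/-- `(X',Ω')` is an `(ε,δ)`-coreset for `(k,X,Ω,A,K)`, witnessed by the extension `f`
and the offsets `Δp`, `Δm`. -/
def IsCoresetWith {d k n m : ℕ} (ε δ : ℝ) (κlo κhi : Fin k → ℝ)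
    (A : Fin k → Matrix (Fin d) (Fin d) ℝ)
    (x : Fin n → Fin d → ℝ) (ω : Fin n → ℝ)
    (x' : Fin m → Fin d → ℝ) (ω' : Fin m → ℝ)
    (f : (Fin k → Fin m → ℝ) → (Fin k → Fin n → ℝ)) (Δp Δm : ℝ) : Prop :=
  0 ≤ Δp ∧ Δp ≤ δ * Δm ∧
  (∀ ξ', IsWCC κlo κhi ω' ξ' → IsWCC κlo κhi ω (f ξ')) ∧
  ∀ (s : Fin k → Fin d → ℝ) (ξ' : Fin k → Fin m → ℝ), IsWCC κlo κhi ω' ξ' →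
    (1 - ε) * cost A x ω (f ξ') s ≤ cost A x' ω' ξ' s + Δp ∧
    assignCost κlo κhi A x' ω' s + Δm ≤ (1 + ε) * assignCost κlo κhi A x ω s


theorem anormSq_nonneg {d : ℕ} {A : Matrix (Fin d) (Fin d) ℝ} (hA : A.PosSemidef)
    (v : Fin d → ℝ) : 0 ≤ anormSq A v := by
  simpa [anormSq] using hA.dotProduct_mulVec_nonneg v

theorem assignCost_nonneg {d k n : ℕ} (κlo κhi : Fin k → ℝ)
    (A : Fin k → Matrix (Fin d) (Fin d) ℝ) (hA : ∀ i, (A i).PosSemidef)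
    (x : Fin n → Fin d → ℝ) (ω : Fin n → ℝ) (hω : ∀ j, 0 ≤ ω j) (s : Fin k → Fin d → ℝ) :
    0 ≤ assignCost κlo κhi A x ω s := by
  refine Real.sInf_nonneg ?_
  rintro _ ⟨ξ, hξ, rfl⟩
  exact sum_nonneg fun i _ => sum_nonneg fun j _ =>
    mul_nonneg (mul_nonneg (hξ.1.1 i j) (hω j)) (anormSq_nonneg (hA i) _)

theorem statement4 {d k n m : ℕ} (ε δ : ℝ) (hε : 0 < ε ∧ ε ≤ 1 / 2) (hδ : 1 ≤ δ)
    (κlo κhi : Fin k → ℝ) (hκ : ∀ i, κlo i ≤ κhi i)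
    (A : Fin k → Matrix (Fin d) (Fin d) ℝ) (hA : ∀ i, (A i).PosDef)
    (x : Fin n → Fin d → ℝ) (ω : Fin n → ℝ) (hω : ∀ j, 0 < ω j)
    (x' : Fin m → Fin d → ℝ) (ω' : Fin m → ℝ) (hω' : ∀ j, 0 < ω' j)
    (hne : ∃ ξ, IsWCC κlo κhi ω ξ) (hne' : ∃ ξ', IsWCC κlo κhi ω' ξ')
    (f : (Fin k → Fin m → ℝ) → (Fin k → Fin n → ℝ)) (Δp Δm : ℝ)
    (hcs : IsCoresetWith (ε / 3) δ κlo κhi A x ω x' ω' f Δp Δm)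
    (S : Fin k → Fin d → ℝ)
    (ξ' : Fin k → Fin m → ℝ) (hξ' : IsWCC κlo κhi ω' ξ')
    (γ : ℝ) (hγ : δ ≤ γ)
    (happrox : cost A x' ω' ξ' S ≤ γ * assignCost κlo κhi A x' ω' S) :
    cost A x ω (f ξ') S ≤ (1 + ε) * γ * assignCost κlo κhi A x ω S := by
  obtain ⟨hΔp, hΔ, -, hc⟩ := hcs
  obtain ⟨hlo, hup⟩ := hc S ξ' hξ'
  have hΔm : 0 ≤ Δm := nonneg_of_mul_nonneg_right (hΔp.trans hΔ) (by linarith)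
  have ha := assignCost_nonneg κlo κhi A (fun i => (hA i).posSemidef) x ω (fun j => (hω j).le) S
  have hγ0 : 0 ≤ γ := by linarith
  refine le_of_mul_le_mul_left ?_ (show 0 < 1 - ε / 3 by linarith)
  calc (1 - ε / 3) * cost A x ω (f ξ') S
      ≤ γ * assignCost κlo κhi A x' ω' S + δ * Δm := by linarith
    _ ≤ γ * (assignCost κlo κhi A x' ω' S + Δm) := by
      rw [mul_add]
      gcongr
    _ ≤ γ * ((1 + ε / 3) * assignCost κlo κhi A x ω S) := by gcongr
    _ = (1 + ε / 3) * (γ * assignCost κlo κhi A x ω S) := by ring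
    _ ≤ ((1 - ε / 3) * (1 + ε)) * (γ * assignCost κlo κhi A x ω S) := by
      gcongr
      nlinarith
    _ = (1 - ε / 3) * ((1 + ε) * γ * assignCost κlo κhi A x ω S) := by ring

end
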